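/- arXiv:1607.06078 — 2 statements merged into one kernel-verified Lean document; each statement's English description precedes it below -/
import Mathlib

section
/- Let X be a metric space, T a multivalued map from X to nonempty subsets of X which is a generalized multivalued hybrid mapping type I: for all x, y ∈ X and all u ∈ Tx, v ∈ Ty, d(u,v)² ≤ a₁(x)d(x,y)² + a₂(x)d(u,y)² + a₃(x)d(x,v)² + k₁(x)d(u,x)² + k₂(x)d(v,y)², with a₁,a₂,a₃,k₁,k₂ : X → [0,1], a₁+a₂+a₃ < 1, 2k₁ < 1−a₂, 2k₂ < 1−a₃ pointwise. If {xₙ} is a sequence with xₙ ∈ Txₙ for each n (each xₙ a fixed point with Txₙ = {xₙ}) and xₙ → x, then Tx = {x}. -/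
theorem generalized_multivalued_hybrid_typeI_fixed_points
    {X : Type*} [MetricSpace X] (T : X → Set X)
    (hTne : ∀ x, (T x).Nonempty)
    (a₁ a₂ a₃ k₁ k₂ : X → ℝ)
    (hrange : ∀ x, a₁ x ∈ Set.Icc (0 : ℝ) 1 ∧ a₂ x ∈ Set.Icc (0 : ℝ) 1 ∧
      a₃ x ∈ Set.Icc (0 : ℝ) 1 ∧ k₁ x ∈ Set.Icc (0 : ℝ) 1 ∧ k₂ x ∈ Set.Icc (0 : ℝ) 1)
    (hsum : ∀ x, a₁ x + a₂ x + a₃ x < 1)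
    (hk₁ : ∀ x, 2 * k₁ x < 1 - a₂ x)
    (hk₂ : ∀ x, 2 * k₂ x < 1 - a₃ x)
    (hT : ∀ x y : X, ∀ u ∈ T x, ∀ v ∈ T y,
      dist u v ^ 2 ≤ a₁ x * dist x y ^ 2 + a₂ x * dist u y ^ 2 +
        a₃ x * dist x v ^ 2 + k₁ x * dist u x ^ 2 + k₂ x * dist v y ^ 2)
    (xseq : ℕ → X) (hfix : ∀ n, T (xseq n) = {xseq n})
    (x : X) (hlim : Filter.Tendsto xseq Filter.atTop (nhds x)) :
    T x = {x} := by
  have key : ∀ u ∈ T x, u = x := by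
    intro u hu
    have h1 : Filter.Tendsto (fun n => dist u (xseq n)) Filter.atTop (nhds (dist u x)) :=
      tendsto_const_nhds.dist hlim
    have h2 : Filter.Tendsto (fun n => dist x (xseq n)) Filter.atTop (nhds (dist x x)) :=
      tendsto_const_nhds.dist hlim
    have h3 : Filter.Tendsto (fun n => a₁ x * dist x (xseq n) ^ 2 + a₂ x * dist u (xseq n) ^ 2 +
        a₃ x * dist x (xseq n) ^ 2 + k₁ x * dist u x ^ 2) Filter.atTop
        (nhds (a₁ x * dist x x ^ 2 + a₂ x * dist u x ^ 2 +
        a₃ x * dist x x ^ 2 + k₁ x * dist u x ^ 2)) :=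
      ((((h2.pow 2).const_mul _).add ((h1.pow 2).const_mul _)).add
        ((h2.pow 2).const_mul _)).add tendsto_const_nhds
    have h4 := le_of_tendsto_of_tendsto' (h1.pow 2) h3 (fun n => by
      have := hT x (xseq n) u hu (xseq n) (by rw [hfix n]; rfl)
      simpa using this)
    rw [dist_self] at h4
    have hk0 : 0 ≤ k₁ x := (hrange x).2.2.2.1.1
    have hk := hk₁ x
    by_contra hne
    have hpos : 0 < dist u x ^ 2 := pow_pos (dist_pos.2 hne) 2
    have hc : 0 < 1 - a₂ x - k₁ x := by linarith
    nlinarith [mul_pos hc hpos]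
  obtain ⟨u, hu⟩ := hTne x
  exact Set.eq_singleton_iff_unique_mem.2 ⟨key u hu ▸ hu, key⟩
end

section
/- Let H be a real Hilbert space and K ⊆ H closed convex with p ∈ K. Suppose T maps K to nonempty subsets of K with Tp = {p}, and there are constants c ∈ [0,1), λ ∈ [0,1] with the property that for all x ∈ K and u ∈ Tx: ‖u − p‖² ≤ ‖x − p‖² + c·‖u − x‖². If moreover βₙ ∈ [b, B] ⊆ (0,1) with (1−βₙ)·1 − c > δ > 0 (i.e., βₙ(c − (1−βₙ)) ≤ −δβₙ < 0), then for yₙ = (1−βₙ)xₙ + βₙvₙ with vₙ ∈ Txₙ: ‖yₙ − p‖² ≤ ‖xₙ − p‖² − δ·βₙ·‖vₙ − xₙ‖². Consequently if ‖xₙ − p‖² − ‖yₙ − p‖² → 0 then ‖vₙ − xₙ‖ → 0. -/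
theorem one_step_estimate_and_asymptotic_regularity
    {H : Type*} [NormedAddCommGroup H] [InnerProductSpace ℝ H] [CompleteSpace H]
    (K : Set H) (hKc : IsClosed K) (hKconv : Convex ℝ K)
    (p : H) (hpK : p ∈ K)
    (T : H → Set H) (hT : ∀ x ∈ K, (T x).Nonempty ∧ T x ⊆ K)
    (hp : T p = {p})
    (c : ℝ) (hc : c ∈ Set.Ico (0 : ℝ) 1)
    (hquasi : ∀ x ∈ K, ∀ u ∈ T x, ‖u - p‖ ^ 2 ≤ ‖x - p‖ ^ 2 + c * ‖u - x‖ ^ 2)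
    (b B δ : ℝ) (hb : 0 < b) (hB : B < 1) (hδ : 0 < δ)
    (β : ℕ → ℝ) (hβ : ∀ n, β n ∈ Set.Icc b B)
    (hgap : ∀ n, δ ≤ (1 - β n) - c)
    (x v y : ℕ → H) (hxK : ∀ n, x n ∈ K)
    (hv : ∀ n, v n ∈ T (x n))
    (hy : ∀ n, y n = (1 - β n) • x n + β n • v n) :
    (∀ n, ‖y n - p‖ ^ 2 ≤ ‖x n - p‖ ^ 2 - δ * β n * ‖v n - x n‖ ^ 2) ∧
      (Filter.Tendsto (fun n => ‖x n - p‖ ^ 2 - ‖y n - p‖ ^ 2) Filter.atTop (nhds 0) →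
        Filter.Tendsto (fun n => ‖v n - x n‖) Filter.atTop (nhds 0)) := by
  have key : ∀ n, ‖y n - p‖ ^ 2 ≤ ‖x n - p‖ ^ 2 - δ * β n * ‖v n - x n‖ ^ 2 := by
    intro n
    have hβ0 : 0 < β n := lt_of_lt_of_le hb (hβ n).1
    have h1 : y n - p = (x n - p) + β n • (v n - x n) := by
      rw [hy n]; module
    have h2 : v n - p = (x n - p) + (v n - x n) := by abel
    have h3 := hquasi (x n) (hxK n) (v n) (hv n)
    rw [h2, norm_add_sq_real] at h3
    rw [h1, norm_add_sq_real, inner_smul_right, norm_smul, mul_pow, Real.norm_eq_abs, sq_abs]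
    have h4 := mul_le_mul_of_nonneg_left h3 hβ0.le
    have h5 := mul_le_mul_of_nonneg_right (hgap n)
      (mul_nonneg hβ0.le (sq_nonneg ‖v n - x n‖))
    nlinarith [h4, h5]
  refine ⟨key, fun h => ?_⟩
  have hsq : Filter.Tendsto (fun n => ‖v n - x n‖ ^ 2) Filter.atTop (nhds 0) := by
    have h' := h.div_const (δ * b)
    rw [zero_div] at h'
    refine squeeze_zero (fun n => sq_nonneg _) (fun n => ?_) h'
    rw [le_div_iff₀ (mul_pos hδ hb)]
    have h6 := mul_le_mul_of_nonneg_right (mul_le_mul_of_nonneg_left (hβ n).1 hδ.le)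
      (sq_nonneg ‖v n - x n‖)
    linarith [key n]
  have h7 := hsq.sqrt
  simpa [Real.sqrt_sq (norm_nonneg _)] using h7
end
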